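/- Let X be a Banach space. If T ∈ GL(X) is topologically stable, then T has the shadowing property and the strict periodic shadowing property. -/

import Mathlib

open Filter Topology Set

section Defs

variable {𝕂 : Type*} [RCLike 𝕂] {X : Type*} [NormedAddCommGroup X] [NormedSpace 𝕂 X]

/-- `T` is topologically stable: for every `ε > 0` there is `δ > 0` such that any homeomorphism
`S : X → X` with `‖T x - S x‖ < δ` for all `x` is semiconjugate to `T` via a continuous map `φ`
with `‖φ x - x‖ < ε` for all `x`. -/
def TopologicallyStableBanach (T : X → X) : Prop :=
  ∀ ε > (0 : ℝ), ∃ δ > (0 : ℝ), ∀ S : X ≃ₜ X,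
    (∀ x : X, ‖T x - S x‖ < δ) →
    ∃ φ : X → X, Continuous φ ∧ (∀ x : X, T (φ x) = φ (S x)) ∧ ∀ x : X, ‖φ x - x‖ < ε

/-- `T` has the (two-sided) shadowing property. -/
def ShadowingPropertyBanach (T : X ≃L[𝕂] X) : Prop :=
  ∀ ε > (0 : ℝ), ∃ δ > (0 : ℝ), ∀ x : ℤ → X,
    (∀ j : ℤ, ‖T (x j) - x (j + 1)‖ < δ) →
    ∃ y : X, ∀ j : ℤ, ‖x j - (T ^ j) y‖ < ε

/-- `T` has the strict periodic shadowing property: every `δ`-cycle `(x_j)_{j=0}^k` for `T` is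
`ε`-shadowed by the trajectory of some `y` with `Tᵏ y = y`. -/
def StrictPeriodicShadowingPropertyBanach (T : X → X) : Prop :=
  ∀ ε > (0 : ℝ), ∃ δ > (0 : ℝ), ∀ (k : ℕ), 1 ≤ k → ∀ x : ℕ → X,
    (∀ j < k, ‖T (x j) - x (j + 1)‖ < δ) → x k = x 0 →
    ∃ y : X, T^[k] y = y ∧ ∀ j ≤ k, ‖x j - T^[j] y‖ < ε

end Defs

theorem exists_homeomorph_eq_add_of_lipschitz {X : Type*} [NormedAddCommGroup X] [NormedSpace ℝ X]
    [CompleteSpace X] (T : X ≃L[ℝ] X) :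
    ∃ c > (0 : ℝ), ∀ g : X → X, (∀ x y, ‖g x - g y‖ ≤ c * ‖x - y‖) →
      ∃ S : X ≃ₜ X, ∀ x, S x = T x + g x := by
  rcases subsingleton_or_nontrivial X with h | h
  · exact ⟨1, one_pos, fun g _ => ⟨Homeomorph.refl X, fun x => Subsingleton.elim _ _⟩⟩
  have hpos : 0 < ‖(T.symm : X →L[ℝ] X)‖₊ := by
    have := T.norm_symm_pos
    exact_mod_cast this
  have hc : 0 < ‖(T.symm : X →L[ℝ] X)‖₊⁻¹ / 2 := by positivity
  refine ⟨((‖(T.symm : X →L[ℝ] X)‖₊⁻¹ / 2 : NNReal) : ℝ), by exact_mod_cast hc, fun g hg => ?_⟩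
  have happrox : ApproximatesLinearOn (fun x => T x + g x) (T : X →L[ℝ] X) univ
      (‖(T.symm : X →L[ℝ] X)‖₊⁻¹ / 2) := by
    intro x _ y _
    have h : T x + g x - (T y + g y) - (T : X →L[ℝ] X) (x - y) = g x - g y := by
      rw [ContinuousLinearEquiv.coe_coe, map_sub]; abel
    rw [h]
    exact hg x y
  exact ⟨happrox.toHomeomorph _ (Or.inr (NNReal.half_lt_self (by positivity))), fun x => rfl⟩

/-- Interpolation of prescribed values at separated points by a bounded field with small
Lipschitz constant. -/
theorem exists_lipschitz_interpolation {X : Type*} [NormedAddCommGroup X] [NormedSpace ℝ X]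
    (n : ℕ) (x w : ℕ → X) {r η : ℝ} (hr : 0 < r) (hη : 0 ≤ η)
    (hsep : ∀ i < n, ∀ j < n, i ≠ j → 2 * r ≤ ‖x i - x j‖) (hw : ∀ j, ‖w j‖ ≤ η) :
    ∃ g : X → X, (∀ j < n, g (x j) = w j) ∧ (∀ p, ‖g p‖ ≤ η) ∧
      ∀ p q, ‖g p - g q‖ ≤ n * η / r * ‖p - q‖ := by
  set b : ℕ → X → ℝ := fun j p => max (1 - ‖p - x j‖ / r) 0 with hb
  have hb0 : ∀ j p, r ≤ ‖p - x j‖ → b j p = 0 := fun j p h => by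
    have : 1 ≤ ‖p - x j‖ / r := (one_le_div hr).2 h
    exact max_eq_right (by linarith)
  have hbn : ∀ j p, 0 ≤ b j p := fun j p => le_max_right _ _
  have hb1 : ∀ j p, b j p ≤ 1 := fun j p => by
    have : 0 ≤ ‖p - x j‖ / r := by positivity
    exact max_le (by linarith) zero_le_one
  have hsingle : ∀ p, ∀ j < n, ‖p - x j‖ < r →
      ∑ i ∈ Finset.range n, b i p • w i = b j p • w j := fun p j hj hp => by
    refine Finset.sum_eq_single j (fun i hi hij => ?_) (fun h => absurd (Finset.mem_range.2 hj) h)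
    rw [hb0, zero_smul]
    have h1 := hsep i (Finset.mem_range.1 hi) j hj hij
    have h2 := norm_sub_le (p - x j) (p - x i)
    rw [sub_sub_sub_cancel_left] at h2
    linarith
  have hbl : ∀ j p q, |b j p - b j q| ≤ ‖p - q‖ / r := fun j p q => by
    have h1 : |b j p - b j q| ≤ |(1 - ‖p - x j‖ / r) - (1 - ‖q - x j‖ / r)| :=
      abs_max_sub_max_le_abs _ _ _
    refine h1.trans ?_
    have h2 : (1 - ‖p - x j‖ / r) - (1 - ‖q - x j‖ / r) = (‖q - x j‖ - ‖p - x j‖) / r := by ring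
    rw [h2, abs_div, abs_of_pos hr]
    gcongr
    have := abs_norm_sub_norm_le (q - x j) (p - x j)
    rwa [sub_sub_sub_cancel_right, norm_sub_rev q p] at this
  refine ⟨fun p => ∑ i ∈ Finset.range n, b i p • w i, fun j hj => ?_, fun p => ?_, fun p q => ?_⟩
  · dsimp only
    rw [hsingle _ j hj (by simpa using hr)]
    simp [hb]
  · dsimp only
    by_cases h : ∃ j < n, ‖p - x j‖ < r
    · obtain ⟨j, hj, hp⟩ := h
      rw [hsingle p j hj hp, norm_smul, Real.norm_of_nonneg (hbn j p)]
      exact (mul_le_of_le_one_left (norm_nonneg _) (hb1 j p)).trans (hw j)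
    · push Not at h
      rw [Finset.sum_eq_zero fun i hi => by
        rw [hb0 i p (h i (Finset.mem_range.1 hi)), zero_smul], norm_zero]
      exact hη
  · dsimp only
    rw [← Finset.sum_sub_distrib]
    calc ‖∑ i ∈ Finset.range n, (b i p • w i - b i q • w i)‖
        ≤ ∑ i ∈ Finset.range n, ‖p - q‖ / r * η := by
          refine norm_sum_le_of_le _ fun i _ => ?_
          rw [← sub_smul, norm_smul, Real.norm_eq_abs]
          gcongr
          exacts [hbl i p q, hw i]
      _ = n * η / r * ‖p - q‖ := by
          rw [Finset.sum_const, Finset.card_range, nsmul_eq_mul]; ring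

theorem exists_separated_pseudo_orbit {X : Type*} [NormedAddCommGroup X] [NormedSpace ℝ X]
    (T : X ≃L[ℝ] X) (hT : ∀ k ≥ 1, ∃ v, T^[k] v ≠ v) (n : ℕ) (w : ℕ → X) (M : ℝ) :
    ∃ x : ℕ → X, (∀ j, x (j + 1) = T (x j) + w j) ∧
      ∀ i < n, ∀ j < n, i ≠ j → M ≤ ‖x i - x j‖ := by
  obtain ⟨v, hv⟩ := hT n.factorial n.factorial_pos
  have hne : ∀ i < n, ∀ j < n, i < j → T^[i] v ≠ T^[j] v := fun i hi j hj hij h => hv <| by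
    have h1 : T^[j - i] v = v := by
      apply T.injective.iterate i
      rw [← Function.iterate_add_apply, Nat.add_sub_cancel' hij.le, h]
    obtain ⟨m, hm⟩ := Nat.dvd_factorial (Nat.sub_pos_of_lt hij) (show j - i ≤ n by omega)
    rw [hm]
    exact (Function.IsPeriodicPt.mul_const (show Function.IsPeriodicPt T (j - i) v from h1) m)
  have hne' : ∀ i < n, ∀ j < n, i ≠ j → T^[i] v - T^[j] v ≠ 0 := fun i hi j hj hij => by
    rw [sub_ne_zero]
    rcases lt_or_gt_of_ne hij with h | h
    exacts [hne i hi j hj h, (hne j hj i hi h).symm]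
  let a : ℕ → X := fun j => Nat.rec 0 (fun j p => T p + w j) j
  have ha : ∀ j, a (j + 1) = T (a j) + w j := fun j => rfl
  have hev : ∀ i < n, ∀ j < n, i ≠ j → ∀ᶠ R : ℝ in atTop,
      M ≤ ‖(R • T^[i] v + a i) - (R • T^[j] v + a j)‖ := fun i hi j hj hij => by
    have hd : 0 < ‖T^[i] v - T^[j] v‖ := norm_pos_iff.2 (hne' i hi j hj hij)
    filter_upwards [eventually_ge_atTop ((M + ‖a j - a i‖) / ‖T^[i] v - T^[j] v‖),
      eventually_ge_atTop 0] with R hR hR0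
    rw [div_le_iff₀ hd] at hR
    have h1 := norm_sub_norm_le (R • (T^[i] v - T^[j] v)) (a j - a i)
    rw [norm_smul, Real.norm_of_nonneg hR0] at h1
    have h2 : (R • T^[i] v + a i) - (R • T^[j] v + a j)
        = R • (T^[i] v - T^[j] v) - (a j - a i) := by rw [smul_sub]; abel
    rw [h2]
    linarith
  have hall : ∀ᶠ R : ℝ in atTop, ∀ i ∈ Finset.range n, ∀ j ∈ Finset.range n, i ≠ j →
      M ≤ ‖(R • T^[i] v + a i) - (R • T^[j] v + a j)‖ := by
    rw [Filter.eventually_all_finset]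
    intro i hi
    rw [Filter.eventually_all_finset]
    intro j hj
    by_cases hij : i = j
    · exact Eventually.of_forall fun R h => absurd hij h
    · filter_upwards [hev i (Finset.mem_range.1 hi) j (Finset.mem_range.1 hj) hij] with R hR _
      exact hR
  obtain ⟨R, hR⟩ := hall.exists
  refine ⟨fun j => R • T^[j] v + a j, fun j => ?_, fun i hi j hj hij =>
    hR i (Finset.mem_range.2 hi) j (Finset.mem_range.2 hj) hij⟩
  dsimp only
  rw [ha, Function.iterate_succ_apply', map_add, map_smul, add_assoc]

theorem TopologicallyStableBanach.exists_iterate_ne {X : Type*} [NormedAddCommGroup X]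
    [NormedSpace ℝ X] [CompleteSpace X] [Nontrivial X] (T : X ≃L[ℝ] X)
    (hT : TopologicallyStableBanach T) (k : ℕ) (hk : 1 ≤ k) : ∃ v, T^[k] v ≠ v := by
  by_contra! hper
  obtain ⟨δ, hδ, hδS⟩ := hT 1 one_pos
  obtain ⟨c, hc, hcS⟩ := exists_homeomorph_eq_add_of_lipschitz T
  set L : ℝ := ‖(T : X →L[ℝ] X)‖ with hL
  have hTL : ∀ x, ‖T x‖ ≤ L * ‖x‖ := (T : X →L[ℝ] X).le_opNorm
  have hL0 : 0 ≤ L := norm_nonneg _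
  obtain ⟨η, hη, hη1, hη2⟩ : ∃ η > 0, η * L < δ ∧ 2 * η * L ≤ c := by
    refine ⟨min δ c / (2 * (L + 1)), by positivity, ?_, ?_⟩
    · rw [div_mul_eq_mul_div, div_lt_iff₀ (by positivity)]
      have := min_le_left δ c
      have : 0 < min δ c := lt_min hδ hc
      nlinarith
    · have h : 2 * (min δ c / (2 * (L + 1))) * L = min δ c * L / (L + 1) := by
        field_simp
      rw [h, div_le_iff₀ (by positivity)]
      have := min_le_right δ c
      nlinarith
  let ρ : X → ℝ := fun x => (1 + ‖x‖)⁻¹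
  have hρ0 : ∀ x, 0 < ρ x := fun x => by positivity
  have hρ1 : ∀ x, ρ x ≤ 1 := fun x => inv_le_one_of_one_le₀ (le_add_of_nonneg_right (norm_nonneg x))
  have hρm : ∀ x, ρ x * ‖x‖ ≤ 1 := fun x => by
    rw [inv_mul_le_iff₀ (by positivity)]; linarith
  have hρs : ∀ x y, |ρ x - ρ y| ≤ ρ x * ρ y * ‖x - y‖ := fun x y => by
    have h : ρ x - ρ y = ρ x * ρ y * (‖y‖ - ‖x‖) := by
      have : 1 + ‖x‖ ≠ 0 := by positivity
      have : 1 + ‖y‖ ≠ 0 := by positivity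
      simp only [ρ]
      field_simp
      ring
    rw [h, abs_mul, abs_of_pos (mul_pos (hρ0 x) (hρ0 y)), norm_sub_rev]
    exact mul_le_mul_of_nonneg_left (abs_norm_sub_norm_le y x) (mul_pos (hρ0 x) (hρ0 y)).le
  have hlip : ∀ x y, ‖ρ x • x - ρ y • y‖ ≤ 2 * ‖x - y‖ := fun x y => by
    have h : ρ x • x - ρ y • y = ρ x • (x - y) + (ρ x - ρ y) • y := by
      rw [smul_sub, sub_smul]; abel
    rw [h]
    refine (norm_add_le _ _).trans ?_
    rw [norm_smul, norm_smul, Real.norm_eq_abs, Real.norm_eq_abs, abs_of_pos (hρ0 x)]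
    have h1 : ρ x * ‖x - y‖ ≤ 1 * ‖x - y‖ := by gcongr; exact hρ1 x
    have h2 : |ρ x - ρ y| * ‖y‖ ≤ 1 * ‖x - y‖ := by
      calc |ρ x - ρ y| * ‖y‖ ≤ ρ x * ρ y * ‖x - y‖ * ‖y‖ := by gcongr; exact hρs x y
        _ = ρ x * (ρ y * ‖y‖) * ‖x - y‖ := by ring
        _ ≤ 1 * 1 * ‖x - y‖ := by
          gcongr
          exacts [hρ1 x, hρm y]
        _ = 1 * ‖x - y‖ := by ring
    linarith
  obtain ⟨S, hS⟩ := hcS (fun x => η • T (ρ x • x)) fun x y => by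
    rw [← smul_sub, ← map_sub, norm_smul, Real.norm_of_nonneg hη.le]
    calc η * ‖T (ρ x • x - ρ y • y)‖ ≤ η * (L * (2 * ‖x - y‖)) := by
          gcongr
          exact (hTL _).trans (by gcongr; exact hlip x y)
      _ = 2 * η * L * ‖x - y‖ := by ring
      _ ≤ c * ‖x - y‖ := by gcongr
  obtain ⟨φ, -, hφ, hφ1⟩ := hδS S fun x => by
    rw [hS, sub_add_cancel_left, norm_neg, norm_smul, Real.norm_of_nonneg hη.le]
    refine lt_of_le_of_lt ?_ hη1
    gcongr
    refine (hTL _).trans (mul_le_of_le_one_right hL0 ?_)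
    rw [norm_smul, Real.norm_of_nonneg (hρ0 x).le]
    exact hρm x
  obtain ⟨v, hv⟩ := exists_ne (0 : X)
  have hφj : ∀ j, φ (S^[j] v) = T^[j] (φ v) := fun j =>
    (Function.Semiconj.iterate_right (f := φ) (ga := S) (gb := T) (fun x => (hφ x).symm) j).eq v
  set B : ℝ := ∑ i ∈ Finset.range k, ‖T^[i] (φ v)‖ with hB
  have hB0 : 0 ≤ B := Finset.sum_nonneg fun i _ => norm_nonneg _
  have hbound : ∀ j, ‖S^[j] v‖ ≤ B + 1 := fun j => by
    have h1 : ‖T^[j] (φ v)‖ ≤ B := by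
      rw [← Function.IsPeriodicPt.iterate_mod_apply (hper (φ v)) j]
      exact Finset.single_le_sum (f := fun i => ‖T^[i] (φ v)‖) (fun i _ => norm_nonneg _)
        (Finset.mem_range.2 (Nat.mod_lt _ hk))
    have h2 := hφ1 (S^[j] v)
    have h3 := norm_sub_norm_le (S^[j] v) (φ (S^[j] v))
    rw [norm_sub_rev] at h3
    rw [← hφj] at h1
    linarith
  set μ : ℝ := 1 + η * (1 + (B + 1))⁻¹ with hμ
  have hμ1 : 1 < μ := by
    have : 0 < η * (1 + (B + 1))⁻¹ := by positivity
    linarith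
  have hgrow : ∀ j, ∃ a : ℝ, μ ^ j ≤ a ∧ S^[j] v = a • T^[j] v := fun j => by
    induction j with
    | zero => exact ⟨1, by simp, by simp⟩
    | succ j ih =>
      obtain ⟨a, ha, haS⟩ := ih
      refine ⟨(1 + η * ρ (S^[j] v)) * a, ?_, ?_⟩
      · rw [pow_succ']
        have h1 : (1 + (B + 1))⁻¹ ≤ ρ (S^[j] v) :=
          inv_anti₀ (by positivity) (by linarith [hbound j])
        have h2 : μ ≤ 1 + η * ρ (S^[j] v) := by rw [hμ]; gcongr
        exact mul_le_mul h2 ha (by positivity) (by linarith)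
      · rw [Function.iterate_succ_apply', Function.iterate_succ_apply', hS, map_smul]
        generalize ρ (S^[j] v) = t
        rw [haS, map_smul]
        module
  have hv0 : 0 < ‖v‖ := norm_pos_iff.2 hv
  obtain ⟨m, hm⟩ := pow_unbounded_of_one_lt ((B + 1) / ‖v‖) hμ1
  obtain ⟨a, ha, haS⟩ := hgrow (k * m)
  have h1 := hbound (k * m)
  have h2 : T^[k * m] v = v :=
    Function.IsPeriodicPt.mul_const (show Function.IsPeriodicPt T k v from hper v) m
  have h3 : μ ^ m ≤ a :=
    (pow_le_pow_right₀ hμ1.le (Nat.le_mul_of_pos_left m hk)).trans ha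
  rw [haS, h2, norm_smul, Real.norm_eq_abs] at h1
  rw [div_lt_iff₀ hv0] at hm
  nlinarith [le_abs_self a]

theorem TopologicallyStableBanach.exists_finite_solution {X : Type*} [NormedAddCommGroup X]
    [NormedSpace ℝ X] [CompleteSpace X] (T : X ≃L[ℝ] X) (hT : TopologicallyStableBanach T) :
    ∃ K > (0 : ℝ), ∀ (n : ℕ) (z : ℕ → X), (∀ j, ‖z j‖ ≤ 1) →
      ∃ y : ℕ → X, (∀ j, ‖y j‖ ≤ K) ∧ ∀ j < n, y (j + 1) = T (y j) + z j := by
  rcases subsingleton_or_nontrivial X with h | h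
  · exact ⟨1, one_pos, fun n z _ =>
      ⟨0, fun j => by simp, fun j _ => Subsingleton.elim _ _⟩⟩
  obtain ⟨δ, hδ, hδS⟩ := hT 1 one_pos
  obtain ⟨c, hc, hcS⟩ := exists_homeomorph_eq_add_of_lipschitz T
  refine ⟨2 / δ, by positivity, fun n z hz => ?_⟩
  obtain ⟨r, hr, hrc⟩ : ∃ r > 0, n * (δ / 2) / r ≤ c := by
    refine ⟨(n + 1) * (δ / 2) / c, by positivity, ?_⟩
    rw [div_le_iff₀ (by positivity), mul_div_cancel₀ _ hc.ne']
    gcongr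
    linarith
  have hw : ∀ j, ‖-((δ / 2) • z j)‖ ≤ δ / 2 := fun j => by
    rw [norm_neg, norm_smul, Real.norm_of_nonneg (by positivity)]
    exact mul_le_of_le_one_right (by positivity) (hz j)
  obtain ⟨x, hx, hsep⟩ := exists_separated_pseudo_orbit T (hT.exists_iterate_ne T) n
    (fun j => -((δ / 2) • z j)) (2 * r)
  obtain ⟨g, hgx, hgb, hgl⟩ := exists_lipschitz_interpolation n x
    (fun j => -((δ / 2) • z j)) hr (half_pos hδ).le hsep hw
  obtain ⟨S, hS⟩ := hcS g fun p q => (hgl p q).trans (by gcongr)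
  obtain ⟨φ, -, hφ, hφ1⟩ := hδS S fun p => by
    rw [hS, sub_add_cancel_left, norm_neg]
    linarith [hgb p]
  refine ⟨fun j => (2 / δ) • (φ (x j) - x j), fun j => ?_, fun j hj => ?_⟩
  · rw [norm_smul, Real.norm_of_nonneg (by positivity)]
    exact mul_le_of_le_one_right (by positivity) (hφ1 _).le
  · have h1 : S (x j) = x (j + 1) := by rw [hS, hgx j hj, hx]
    have h2 : z j = (2 / δ) • ((δ / 2) • z j) := by
      rw [smul_smul, div_mul_div_cancel₀ hδ.ne', div_self two_ne_zero, one_smul]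
    have h3 : T (x j) = x (j + 1) + (δ / 2) • z j := by rw [hx]; abel
    dsimp only
    conv_rhs => rw [h2]
    rw [map_smul, map_sub, hφ, h1, h3, ← smul_add]
    congr 1
    abel

/-- Successive approximation: an equation along `σ` that can be solved up to error `1 / 2` with
a uniform bound can be solved exactly. -/
theorem exists_exact_solution_of_approximate {X : Type*} [NormedAddCommGroup X] [NormedSpace ℝ X]
    [CompleteSpace X] (T : X →L[ℝ] X) {ι : Type*} (σ : ι → ι) {K : ℝ}
    (h : ∀ z : ι → X, (∀ i, ‖z i‖ ≤ 1) → ∃ y : ι → X, (∀ i, ‖y i‖ ≤ K) ∧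
      ∀ i, ‖y (σ i) - T (y i) - z i‖ ≤ 1 / 2)
    (z : ι → X) (hz : ∀ i, ‖z i‖ ≤ 1) :
    ∃ y : ι → X, (∀ i, ‖y i‖ ≤ 2 * K) ∧ ∀ i, y (σ i) = T (y i) + z i := by
  choose! f hf hf' using h
  let r : (ι → X) → ι → X := fun u i => (2 : ℝ) • (u i - (f u (σ i) - T (f u i)))
  let u : ℕ → ι → X := fun m => r^[m] z
  have hu1 : ∀ m i, ‖u m i‖ ≤ 1 := fun m => by
    induction m with
    | zero => exact hz
    | succ m ih =>
      intro i
      have h1 := hf' (u m) ih i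
      rw [norm_sub_rev] at h1
      simp only [u, Function.iterate_succ_apply'] at h1 ⊢
      simp only [r, norm_smul, Real.norm_ofNat] at h1 ⊢
      linarith
  have hus : ∀ m i, (1 / 2 : ℝ) ^ m • (f (u m) (σ i) - T (f (u m) i))
      = (1 / 2 : ℝ) ^ m • u m i - (1 / 2 : ℝ) ^ (m + 1) • u (m + 1) i := fun m i => by
    have h1 : u (m + 1) i = (2 : ℝ) • (u m i - (f (u m) (σ i) - T (f (u m) i))) := by
      simp only [u, Function.iterate_succ_apply', r]
    rw [h1, smul_smul, pow_succ]
    module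
  have hbd : ∀ i m, ‖(1 / 2 : ℝ) ^ m • f (u m) i‖ ≤ K * (1 / 2 : ℝ) ^ m := fun i m => by
    rw [norm_smul, Real.norm_of_nonneg (by positivity), mul_comm]
    gcongr
    exact hf (u m) (hu1 m) i
  have hsumK : HasSum (fun m : ℕ => K * (1 / 2 : ℝ) ^ m) (2 * K) := by
    rw [mul_comm 2 K]
    exact hasSum_geometric_two.mul_left K
  have hsum : ∀ i, Summable fun m => (1 / 2 : ℝ) ^ m • f (u m) i := fun i =>
    Summable.of_norm_bounded hsumK.summable (hbd i)
  refine ⟨fun i => ∑' m, (1 / 2 : ℝ) ^ m • f (u m) i, fun i =>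
    tsum_of_norm_bounded hsumK (hbd i), fun i => ?_⟩
  have h1 : HasSum (fun m => (1 / 2 : ℝ) ^ m • (f (u m) (σ i) - T (f (u m) i)))
      ((∑' m, (1 / 2 : ℝ) ^ m • f (u m) (σ i)) - T (∑' m, (1 / 2 : ℝ) ^ m • f (u m) i)) := by
    simp only [smul_sub]
    refine (hsum _).hasSum.sub ?_
    simpa using T.hasSum (hsum i).hasSum
  have h2 : Tendsto (fun m => (1 / 2 : ℝ) ^ m • u m i) atTop (𝓝 0) := by
    refine squeeze_zero_norm (a := fun m => (1 / 2 : ℝ) ^ m) (fun m => ?_)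
      (tendsto_pow_atTop_nhds_zero_of_lt_one (by norm_num) (by norm_num))
    rw [norm_smul, Real.norm_of_nonneg (by positivity)]
    exact mul_le_of_le_one_right (by positivity) (hu1 m i)
  have h3 := h1.tendsto_sum_nat
  simp only [hus, Finset.sum_range_sub'] at h3
  have h4 : Tendsto (fun m => (1 / 2 : ℝ) ^ 0 • u 0 i - (1 / 2 : ℝ) ^ m • u m i) atTop
      (𝓝 (z i)) := by
    simpa [u, pow_zero, one_smul] using h2.const_sub (z i)
  exact sub_eq_iff_eq_add'.1 (tendsto_nhds_unique h3 h4)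

theorem exists_int_solution_of_finite {X : Type*} [NormedAddCommGroup X] [NormedSpace ℝ X]
    [CompleteSpace X] (T : X →L[ℝ] X) {K : ℝ} (hK : 0 < K)
    (h : ∀ (n : ℕ) (z : ℕ → X), (∀ j, ‖z j‖ ≤ 1) →
      ∃ y : ℕ → X, (∀ j, ‖y j‖ ≤ K) ∧ ∀ j < n, y (j + 1) = T (y j) + z j)
    (z : ℤ → X) (hz : ∀ j, ‖z j‖ ≤ 1) :
    ∃ y : ℤ → X, (∀ j, ‖y j‖ ≤ 2 * K) ∧ ∀ j, y (j + 1) = T (y j) + z j := by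
  refine exists_exact_solution_of_approximate T (fun j : ℤ => j + 1) (fun z hz => ?_) z hz
  obtain ⟨N, hN⟩ := exists_nat_gt (4 * K)
  have hN0 : (0 : ℝ) < N := by linarith
  have hN' : 0 < N := by exact_mod_cast hN0
  choose u hu1 hu using fun q : ℤ => h (2 * N) (fun i => z ((q - 1) * N + i)) fun i => hz _
  let F : ℤ → ℕ → X := fun q r =>
    (1 - (r : ℝ) / N) • u q (r + N) + ((r : ℝ) / N) • u (q + 1) r
  have hFN : ∀ q, F q N = F (q + 1) 0 := fun q => by
    simp [F, div_self hN0.ne']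
  have hFb : ∀ q, ∀ r ≤ N, ‖F q r‖ ≤ K := fun q r hr => by
    have h1 : (r : ℝ) / N ≤ 1 := (div_le_one hN0).2 (by exact_mod_cast hr)
    have h0 : 0 ≤ (r : ℝ) / N := by positivity
    refine (norm_add_le _ _).trans ?_
    rw [norm_smul, norm_smul, Real.norm_of_nonneg h0, Real.norm_of_nonneg (sub_nonneg.2 h1)]
    nlinarith [hu1 q (r + N), hu1 (q + 1) r]
  have hFs : ∀ q, ∀ r < N, ‖F q (r + 1) - T (F q r) - z (q * N + r)‖ ≤ 1 / 2 := fun q r hr => by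
    have e1 := hu q (r + N) (by omega)
    have e2 := hu (q + 1) r (by omega)
    have i1 : (q - 1) * N + ((r + N : ℕ) : ℤ) = q * N + r := by push_cast; ring
    have i2 : (q + 1 - 1) * (N : ℤ) + r = q * N + r := by ring
    rw [i1] at e1
    rw [i2] at e2
    have e3 : F q (r + 1) - T (F q r) - z (q * N + r)
        = (1 / (N : ℝ)) • (u (q + 1) (r + 1) - u q (r + N + 1)) := by
      simp only [F, map_add, map_smul]
      rw [show r + 1 + N = r + N + 1 by ring, e1, e2, Nat.cast_succ, add_div]
      module
    rw [e3, norm_smul, Real.norm_of_nonneg (by positivity), one_div, inv_mul_le_iff₀ hN0]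
    refine (norm_sub_le _ _).trans ?_
    linarith [hu1 (q + 1) (r + 1), hu1 q (r + N + 1)]
  have hpos : (0 : ℤ) < N := by exact_mod_cast hN'
  let Y : ℤ → X := fun j => F (j / N) (j % N).toNat
  have hY : ∀ (q : ℤ) (r : ℕ), r ≤ N → Y (q * N + r) = F q r := fun q r hr => by
    rcases hr.lt_or_eq with hr | rfl
    · have h1 : (q * N + r) / (N : ℤ) = q := by
        rw [add_comm, Int.add_mul_ediv_right _ _ hpos.ne',
          Int.ediv_eq_zero_of_lt (by positivity) (by exact_mod_cast hr), zero_add]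
      have h2 : (q * N + r) % (N : ℤ) = r := by
        rw [add_comm, Int.add_mul_emod_self_right,
          Int.emod_eq_of_lt (by positivity) (by exact_mod_cast hr)]
      simp only [Y, h1, h2, Int.toNat_natCast]
    · have h1 : (q * r + r) / (r : ℤ) = q + 1 := by
        rw [← add_one_mul, Int.mul_ediv_cancel _ hpos.ne']
      have h2 : (q * r + r) % (r : ℤ) = 0 := by
        rw [← add_one_mul, Int.mul_emod_left]
      simp only [Y, h1, h2, Int.toNat_zero, hFN]
  have hdiv : ∀ j : ℤ, ∃ (q : ℤ) (r : ℕ), r < N ∧ j = q * N + r := fun j => by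
    refine ⟨j / N, (j % N).toNat, ?_, ?_⟩
    · have := Int.emod_lt_of_pos j hpos
      omega
    · rw [Int.toNat_of_nonneg (Int.emod_nonneg _ hpos.ne')]
      exact (Int.ediv_mul_add_emod j N).symm
  refine ⟨Y, fun j => ?_, fun j => ?_⟩
  · obtain ⟨q, r, hr, rfl⟩ := hdiv j
    rw [hY q r hr.le]
    exact hFb q r hr.le
  · obtain ⟨q, r, hr, rfl⟩ := hdiv j
    have h1 : q * N + r + 1 = q * (N : ℤ) + ((r + 1 : ℕ) : ℤ) := by push_cast; ring
    rw [h1, hY q _ hr, hY q r hr.le]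
    exact hFs q r hr

theorem exists_cyclic_solution_of_finite {X : Type*} [NormedAddCommGroup X] [NormedSpace ℝ X]
    [CompleteSpace X] (T : X →L[ℝ] X) {K : ℝ} (hK : 0 < K)
    (h : ∀ (n : ℕ) (z : ℕ → X), (∀ j, ‖z j‖ ≤ 1) →
      ∃ y : ℕ → X, (∀ j, ‖y j‖ ≤ K) ∧ ∀ j < n, y (j + 1) = T (y j) + z j)
    {k : ℕ} (hk : 0 < k) (z : ℕ → X) (hz : ∀ j < k, ‖z j‖ ≤ 1) :
    ∃ y : ℕ → X, (∀ j, ‖y j‖ ≤ 2 * K) ∧ ∀ j < k, y ((j + 1) % k) = T (y j) + z j := by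
  suffices H : ∃ y : Fin k → X, (∀ i, ‖y i‖ ≤ 2 * K) ∧
      ∀ i : Fin k, y ⟨(i + 1) % k, Nat.mod_lt _ hk⟩ = T (y i) + z i by
    obtain ⟨y, hy, hy'⟩ := H
    refine ⟨fun j => y ⟨j % k, Nat.mod_lt _ hk⟩, fun j => hy _, fun j hj => ?_⟩
    simpa [Nat.mod_eq_of_lt hj] using hy' ⟨j, hj⟩
  refine exists_exact_solution_of_approximate T
    (fun i : Fin k => (⟨(i + 1) % k, Nat.mod_lt _ hk⟩ : Fin k)) (fun z hz => ?_)
    (fun i : Fin k => z i) fun i => hz i i.2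
  obtain ⟨M, hM⟩ := exists_nat_gt (4 * K)
  have hM0 : (0 : ℝ) < M := by linarith
  obtain ⟨y, hy, hy'⟩ := h (M * k) (fun j => z ⟨j % k, Nat.mod_lt _ hk⟩) fun j => hz _
  let Y : ℕ → X := fun j => (M : ℝ)⁻¹ • ∑ m ∈ Finset.range M, y (m * k + j)
  have hYb : ∀ j, ‖Y j‖ ≤ K := fun j => by
    rw [norm_smul, Real.norm_of_nonneg (by positivity), inv_mul_le_iff₀ hM0]
    refine (norm_sum_le_of_le _ fun m _ => hy _).trans ?_
    simp
  have hYs : ∀ j (hj : j < k), Y (j + 1) = T (Y j) + z ⟨j, hj⟩ := fun j hj => by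
    have h1 : ∀ m ∈ Finset.range M,
        y (m * k + (j + 1)) = T (y (m * k + j)) + z ⟨j, hj⟩ := fun m hm => by
      have h2 : m * k + j < M * k := by
        have := Nat.mul_le_mul_right k (Nat.succ_le_of_lt (Finset.mem_range.1 hm))
        rw [Nat.succ_mul] at this
        omega
      have h3 : (m * k + j) % k = j := by
        rw [Nat.mul_add_mod_self_right, Nat.mod_eq_of_lt hj]
      have h4 := hy' _ h2
      simp only [h3] at h4
      exact h4
    simp only [Y]
    rw [Finset.sum_congr rfl h1, Finset.sum_add_distrib, Finset.sum_const, Finset.card_range,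
      smul_add, map_smul, map_sum, ← Nat.cast_smul_eq_nsmul ℝ, smul_smul,
      inv_mul_cancel₀ hM0.ne', one_smul]
  have hYk : ‖Y 0 - Y k‖ ≤ 1 / 2 := by
    have h1 : ∑ m ∈ Finset.range M, y (m * k + 0) - ∑ m ∈ Finset.range M, y (m * k + k)
        = y 0 - y (M * k) := by
      have := Finset.sum_range_sub' (fun m => y (m * k)) M
      simpa [Finset.sum_sub_distrib, Nat.succ_mul] using this
    simp only [Y]
    rw [← smul_sub, h1, norm_smul, Real.norm_of_nonneg (by positivity), inv_mul_le_iff₀ hM0]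
    refine (norm_sub_le _ _).trans ?_
    linarith [hy 0, hy (M * k)]
  refine ⟨fun i => Y i, fun i => hYb i, fun i => ?_⟩
  have h1 := hYs i i.2
  dsimp only
  rcases (Nat.succ_le_of_lt i.2).lt_or_eq with hi | hi
  · rw [Nat.mod_eq_of_lt hi, h1]
    simp
  · have h2 : (i : ℕ) + 1 = k := hi
    rw [h2] at h1 ⊢
    rw [Nat.mod_self, sub_sub, ← h1]
    exact hYk

/-- Let `X` be a Banach space. If `T ∈ GL(X)` is topologically stable, then `T` has the
shadowing property and the strict periodic shadowing property. -/
theorem topologicallyStable_shadowing_banach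
    {𝕂 : Type*} [RCLike 𝕂] {X : Type*} [NormedAddCommGroup X] [NormedSpace 𝕂 X]
    [CompleteSpace X] (T : X ≃L[𝕂] X) (hT : TopologicallyStableBanach (⇑T)) :
    ShadowingPropertyBanach T ∧ StrictPeriodicShadowingPropertyBanach (⇑T) := by
  let _ : NormedSpace ℝ X := NormedSpace.restrictScalars ℝ 𝕂 X
  have _ : IsScalarTower ℝ 𝕂 X := RestrictScalars.isScalarTower ℝ 𝕂 X
  let A : X ≃L[ℝ] X := T.restrictScalars ℝ
  have hA : ∀ x, A x = T x := fun x => rfl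
  obtain ⟨K, hK, hsol⟩ :=
    TopologicallyStableBanach.exists_finite_solution A (show TopologicallyStableBanach A from hT)
  have hscale : ∀ ε > (0 : ℝ), ∃ δ > (0 : ℝ), δ * (2 * K) < ε := fun ε hε => by
    refine ⟨ε / (4 * K), by positivity, ?_⟩
    field_simp
    norm_num
  have hunit : ∀ δ > (0 : ℝ), ∀ x : X, ‖x‖ < δ → ‖δ⁻¹ • x‖ ≤ 1 := fun δ hδ x hx => by
    rw [norm_smul, Real.norm_of_nonneg (by positivity), inv_mul_le_iff₀ hδ, mul_one]
    exact hx.le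
  have hcorr : ∀ δ > (0 : ℝ), ∀ p q y y' : X, y' = A y + δ⁻¹ • (T p - q) →
      q + δ • y' = T (p + δ • y) := fun δ hδ p q y y' h => by
    rw [h, smul_add, smul_smul, mul_inv_cancel₀ hδ.ne', one_smul, ← map_smul, hA, map_add]
    abel
  have hclose : ∀ ε δ : ℝ, 0 < δ → δ * (2 * K) < ε → ∀ x y : X, ‖y‖ ≤ 2 * K →
      ‖x - (x + δ • y)‖ < ε := fun ε δ hδ hδε x y hy => by
    rw [sub_add_cancel_left, norm_neg, norm_smul, Real.norm_of_nonneg hδ.le]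
    exact lt_of_le_of_lt (by gcongr) hδε
  constructor
  · intro ε hε
    obtain ⟨δ, hδ, hδε⟩ := hscale ε hε
    refine ⟨δ, hδ, fun x hx => ?_⟩
    obtain ⟨y, hy, hy'⟩ := exists_int_solution_of_finite (A : X →L[ℝ] X) hK hsol
      (fun j => δ⁻¹ • (T (x j) - x (j + 1))) fun j => hunit δ hδ _ (hx j)
    have hw : ∀ j, x (j + 1) + δ • y (j + 1) = T (x j + δ • y j) := fun j =>
      hcorr δ hδ _ _ _ _ (hy' j)
    have horb : ∀ j : ℤ, (T ^ j) (x 0 + δ • y 0) = x j + δ • y j := fun j => by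
      induction j using Int.induction_on with
      | zero => rw [zpow_zero]; rfl
      | succ j ih => rw [hw, ← ih, add_comm, zpow_one_add]; rfl
      | pred j ih =>
        apply T.injective
        rw [← hw, sub_add_cancel, ← ih]
        conv_rhs => rw [show -(j : ℤ) = 1 + (-j - 1) by ring, zpow_one_add]
        rfl
    refine ⟨x 0 + δ • y 0, fun j => ?_⟩
    rw [horb]
    exact hclose ε δ hδ hδε _ _ (hy j)
  · intro ε hε
    obtain ⟨δ, hδ, hδε⟩ := hscale ε hε
    refine ⟨δ, hδ, fun k hk x hx hxk => ?_⟩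
    obtain ⟨y, hy, hy'⟩ := exists_cyclic_solution_of_finite (A : X →L[ℝ] X) hK hsol hk
      (fun j => δ⁻¹ • (T (x j) - x (j + 1))) fun j hj => hunit δ hδ _ (hx j hj)
    have horb : ∀ j ≤ k, T^[j] (x 0 + δ • y 0) = x j + δ • y (j % k) := fun j => by
      induction j with
      | zero => simp
      | succ j ih =>
        intro hj
        have hj' : j < k := hj
        rw [Function.iterate_succ_apply', ih hj'.le, Nat.mod_eq_of_lt hj']
        exact (hcorr δ hδ _ _ _ _ (hy' j hj')).symm
    refine ⟨x 0 + δ • y 0, ?_, fun j hj => ?_⟩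
    · rw [horb k le_rfl, Nat.mod_self, hxk]
    · rw [horb j hj]
      exact hclose ε δ hδ hδε _ _ (hy _)
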